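/- Let H : W^{1,2}(S^1 × [0,L]) → W^{1,2}(𝔻) denote the operator sending u to the harmonic extension of the boundary trace u(·, L) to the unit disk 𝔻. If L ≥ (3/2)log 2, then ‖dH(u)‖²_{L²(𝔻)} ≤ (1 + Ce^{-2L}) ‖du‖²_{L²(S^1×[0,L])} for a universal constant C. -/

import Mathlib

/-!
STATEMENT 13: Energy bound for the harmonic extension operator
`H : W^{1,2}(S¹ × [0,L]) → W^{1,2}(𝔻)` sending `u` to the harmonic extension
of its boundary trace `u(·,L)`: if `L ≥ (3/2)log 2`, then
`‖dH(u)‖²_{L²(𝔻)} ≤ (1 + C e^{-2L}) ‖du‖²_{L²(cylinder)}` for a universal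
constant `C`.  The cylinder is encoded in coordinates
`(θ,t) ∈ [0,2π] × [0,L] ⊂ ℝ²` (Euclidean metric, `2π`-periodic in `θ`) and
the harmonic extension as a function `v` on the closed unit disk in `ℝ²`,
harmonic in the interior (`Δv = 0`), with boundary values
`v(cos θ, sin θ) = u(θ, L)`.
-/

open Metric MeasureTheory Real

noncomputable section

abbrev E2 := EuclideanSpace ℝ (Fin 2)

def pt (a b : ℝ) : E2 := (WithLp.equiv 2 (Fin 2 → ℝ)).symm ![a, b]

/-- The Laplacian `∂₁² + ∂₂²` on `ℝ²`. -/
def lap (v : E2 → ℝ) (x : E2) : ℝ :=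
  ∑ i : Fin 2, fderiv ℝ (fun y => fderiv ℝ v y (EuclideanSpace.single i (1:ℝ)))
    x (EuclideanSpace.single i (1:ℝ))

open Complex in
lemma integral_exp_int_mul_I (m : ℤ) :
    ∫ θ in (0 : ℝ)..2 * π, Complex.exp (m * θ * I) = if m = 0 then 2 * (π : ℂ) else 0 := by
  split_ifs with h
  · simp [h]
  · have hc : (m * I : ℂ) ≠ 0 := by simp [h]
    have := integral_exp_mul_complex (a := 0) (b := 2 * π) hc
    have e : ∀ θ : ℝ, (m * θ * I : ℂ) = m * I * θ := fun θ => by ring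
    simp_rw [e]
    rw [this]
    have : Complex.exp (m * I * ((2 * π : ℝ) : ℂ)) = 1 := by
      rw [Complex.exp_eq_one_iff]
      exact ⟨m, by push_cast; ring⟩
    rw [this]
    simp

open Complex in
lemma circle_integral_re_mul_exp {F : ℂ → ℂ} (hF : DifferentiableOn ℂ F (ball 0 1)) {r : ℝ}
    (hr0 : 0 < r) (hr1 : r < 1) (n : ℕ) :
    ∫ θ in (0 : ℝ)..2 * π, ((F (circleMap 0 r θ)).re : ℂ) * Complex.exp (-((n + 1 : ℕ) * θ * I))
      = π * (r ^ (n + 1) * (iteratedDeriv (n + 1) F 0 / (n + 1).factorial)) := by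
  have hr : (r : ℂ) ≠ 0 := by exact_mod_cast hr0.ne'
  have hsub : closedBall (0 : ℂ) r ⊆ ball 0 1 := closedBall_subset_ball hr1
  have hcont : Continuous fun θ : ℝ => F (circleMap 0 r θ) := by
    refine hF.continuousOn.comp_continuous (continuous_circleMap 0 r) fun θ => hsub ?_
    exact circleMap_mem_closedBall 0 hr0.le θ
  have h1 := DifferentiableOn.circleIntegral_one_div_sub_center_pow_smul hr0 (n + 1)
    (hF.mono hsub)
  have h2 : ∮ z in C(0, r), z ^ n * F z = 0 := by
    refine Complex.circleIntegral_eq_zero_of_differentiable_on_off_countable hr0.le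
      Set.countable_empty ?_ ?_
    · exact ((continuous_pow n).continuousOn).mul (hF.continuousOn.mono hsub)
    · intro z hz
      exact (differentiableAt_pow n).mul
        (hF.differentiableAt (isOpen_ball.mem_nhds (hsub (ball_subset_closedBall hz.1))))
  rw [circleIntegral] at h1 h2
  have e1 : ∀ θ : ℝ, deriv (circleMap 0 r) θ • (1 / (circleMap 0 r θ - 0) ^ (n + 1 + 1)) •
      F (circleMap 0 r θ) = (I / r ^ (n + 1)) *
        (F (circleMap 0 r θ) * Complex.exp (-((n + 1 : ℕ) * θ * I))) := by
    intro θ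
    have : Complex.exp (θ * I) ≠ 0 := Complex.exp_ne_zero _
    rw [Complex.exp_neg, mul_assoc ((n + 1 : ℕ) : ℂ), Complex.exp_nat_mul]
    simp only [deriv_circleMap, circleMap, zero_add, smul_eq_mul, sub_zero]
    field_simp
    ring
  have e2 : ∀ θ : ℝ, deriv (circleMap 0 r) θ • (circleMap 0 r θ ^ n * F (circleMap 0 r θ)) =
      (I * r ^ (n + 1)) * (F (circleMap 0 r θ) * Complex.exp ((n + 1 : ℕ) * θ * I)) := by
    intro θ
    rw [mul_assoc ((n + 1 : ℕ) : ℂ), Complex.exp_nat_mul]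
    simp only [deriv_circleMap, circleMap, zero_add, smul_eq_mul]
    ring
  simp_rw [e1] at h1
  simp_rw [e2] at h2
  rw [intervalIntegral.integral_const_mul] at h1 h2
  have h2' : ∫ θ in (0 : ℝ)..2 * π, F (circleMap 0 r θ) * Complex.exp ((n + 1 : ℕ) * θ * I) = 0 :=
    (mul_eq_zero.1 h2).resolve_left (mul_ne_zero I_ne_zero (pow_ne_zero _ hr))
  have h3 : ∫ θ in (0 : ℝ)..2 * π, (starRingEnd ℂ) (F (circleMap 0 r θ)) *
      Complex.exp (-((n + 1 : ℕ) * θ * I)) = 0 := by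
    have := congrArg (starRingEnd ℂ) h2'
    rw [intervalIntegral.integral_of_le (by positivity), ← integral_conj, map_zero] at this
    refine Eq.trans ?_ this
    rw [intervalIntegral.integral_of_le (by positivity)]
    congr 1
    ext θ
    simp [← Complex.exp_conj]
  have e3 : ∀ θ : ℝ, ((F (circleMap 0 r θ)).re : ℂ) * Complex.exp (-((n + 1 : ℕ) * θ * I)) =
      (1 / 2 : ℂ) * (F (circleMap 0 r θ) * Complex.exp (-((n + 1 : ℕ) * θ * I)) +
        (starRingEnd ℂ) (F (circleMap 0 r θ)) * Complex.exp (-((n + 1 : ℕ) * θ * I))) := by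
    intro θ
    rw [Complex.re_eq_add_conj]
    ring
  simp_rw [e3]
  rw [intervalIntegral.integral_const_mul, intervalIntegral.integral_add, h3]
  · have hI : (I : ℂ) ≠ 0 := I_ne_zero
    have hf : ((n + 1).factorial : ℂ) ≠ 0 := by exact_mod_cast (n + 1).factorial_ne_zero
    simp only [smul_eq_mul] at h1
    field_simp at h1 ⊢
    linear_combination h1
  · exact Continuous.intervalIntegrable (hcont.mul (by fun_prop)) _ _
  · exact Continuous.intervalIntegrable
      ((Complex.continuous_conj.comp hcont).mul (by fun_prop)) _ _

open Complex Filter Topology in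
lemma boundary_integral_mul_exp {F : ℂ → ℂ} (hF : DifferentiableOn ℂ F (ball 0 1)) {v : ℂ → ℝ}
    (hv : ContinuousOn v (closedBall 0 1)) (hFv : ∀ z ∈ ball (0 : ℂ) 1, (F z).re = v z) (n : ℕ) :
    ∫ θ in (0 : ℝ)..2 * π, (v (circleMap 0 1 θ) : ℂ) * Complex.exp (-((n + 1 : ℕ) * θ * I))
      = π * (iteratedDeriv (n + 1) F 0 / (n + 1).factorial) := by
  obtain ⟨M, hM⟩ := (isCompact_closedBall (0 : ℂ) 1).exists_bound_of_continuousOn hv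
  have hmem : ∀ r ∈ Set.Ioc (0 : ℝ) 1, ∀ θ, circleMap 0 r θ ∈ closedBall (0 : ℂ) 1 := by
    intro r hr θ
    exact closedBall_subset_closedBall hr.2 (circleMap_mem_closedBall 0 hr.1.le θ)
  have hev : ∀ᶠ r : ℝ in 𝓝[<] 1, r ∈ Set.Ioo (0 : ℝ) 1 := Ioo_mem_nhdsLT one_pos
  have hc : ∀ r ∈ Set.Ioc (0 : ℝ) 1, Continuous fun θ : ℝ =>
      (v (circleMap 0 r θ) : ℂ) * Complex.exp (-((n + 1 : ℕ) * θ * I)) := by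
    intro r hr
    exact (Complex.continuous_ofReal.comp
      (hv.comp_continuous (continuous_circleMap 0 r) (hmem r hr))).mul (by fun_prop)
  have hlim : Tendsto (fun r : ℝ => ∫ θ in (0 : ℝ)..2 * π, (v (circleMap 0 r θ) : ℂ) *
      Complex.exp (-((n + 1 : ℕ) * θ * I))) (𝓝[<] 1) (𝓝 (∫ θ in (0 : ℝ)..2 * π,
      (v (circleMap 0 1 θ) : ℂ) * Complex.exp (-((n + 1 : ℕ) * θ * I)))) := by
    refine intervalIntegral.tendsto_integral_filter_of_dominated_convergence (fun _ => M) ?_ ?_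
      (by simp) ?_
    · filter_upwards [hev] with r hr
      exact (hc r ⟨hr.1, hr.2.le⟩).aestronglyMeasurable
    · filter_upwards [hev] with r hr
      refine ae_of_all _ fun θ _ => ?_
      have : ‖Complex.exp (-((n + 1 : ℕ) * θ * I))‖ = 1 := by
        rw [Complex.norm_exp]; simp
      rw [norm_mul, this, mul_one, Complex.norm_real]
      exact hM _ (hmem r ⟨hr.1, hr.2.le⟩ θ)
    · refine ae_of_all _ fun θ _ => ?_
      refine Tendsto.mul ?_ tendsto_const_nhds
      refine (Complex.continuous_ofReal.tendsto _).comp ?_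
      refine (hv _ (hmem 1 (by simp) θ)).tendsto.comp ?_
      refine tendsto_nhdsWithin_iff.2 ⟨?_, ?_⟩
      · refine Tendsto.mono_left (Continuous.tendsto (f := fun r : ℝ => circleMap 0 r θ) ?_ 1)
          nhdsWithin_le_nhds
        unfold circleMap
        fun_prop
      · filter_upwards [hev] with r hr
        exact hmem r ⟨hr.1, hr.2.le⟩ θ
  refine tendsto_nhds_unique hlim ?_
  have : Tendsto (fun r : ℝ => (π * (r ^ (n + 1) *
      (iteratedDeriv (n + 1) F 0 / (n + 1).factorial)) : ℂ)) (𝓝[<] 1)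
      (𝓝 (π * ((1 : ℝ) ^ (n + 1) * (iteratedDeriv (n + 1) F 0 / (n + 1).factorial)))) := by
    refine Tendsto.mono_left (Continuous.tendsto (f := fun r : ℝ => (π * (r ^ (n + 1) *
      (iteratedDeriv (n + 1) F 0 / (n + 1).factorial)) : ℂ)) (by fun_prop) 1) nhdsWithin_le_nhds
  simp only [ofReal_one, one_pow, one_mul] at this
  refine this.congr' ?_
  filter_upwards [hev] with r hr
  rw [← circle_integral_re_mul_exp hF hr.1 hr.2]
  congr 1
  ext θ
  rw [hFv _ (closedBall_subset_ball hr.2 (circleMap_mem_closedBall 0 hr.1.le θ))]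

open Complex in
lemma integral_mul_re_of_fourier {f : ℝ → ℝ} (hf : Continuous f) {n : ℕ} {c : ℂ}
    (h : ∫ θ in (0 : ℝ)..2 * π, (f θ : ℂ) * Complex.exp (-(n * θ * I)) = π * c) (d : ℂ) :
    ∫ θ in (0 : ℝ)..2 * π, f θ * (d * Complex.exp (n * θ * I)).re
      = π * ((starRingEnd ℂ) d * c).re := by
  have e : ∀ θ : ℝ, f θ * (d * Complex.exp (n * θ * I)).re =
      Complex.reCLM ((starRingEnd ℂ) d * ((f θ : ℂ) * Complex.exp (-(n * θ * I)))) := by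
    intro θ
    have : Complex.exp (-(n * θ * I)) = (starRingEnd ℂ) (Complex.exp (n * θ * I)) := by
      simp [← Complex.exp_conj]
    rw [this]
    simp
    ring
  simp_rw [e]
  rw [ContinuousLinearMap.intervalIntegral_comp_comm, intervalIntegral.integral_const_mul, h]
  · simp; ring
  · exact Continuous.intervalIntegrable (by fun_prop) _ _

open Complex in
lemma integral_re_mul_exp (m n : ℕ) (hn : 0 < n) (c : ℂ) :
    ∫ θ in (0 : ℝ)..2 * π, ((c * Complex.exp (m * θ * I)).re : ℂ) * Complex.exp (-(n * θ * I))
      = π * if m = n then c else 0 := by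
  have e : ∀ θ : ℝ, ((c * Complex.exp (m * θ * I)).re : ℂ) * Complex.exp (-(n * θ * I)) =
      c / 2 * Complex.exp (((m - n : ℤ) : ℂ) * θ * I) +
        (starRingEnd ℂ) c / 2 * Complex.exp (((-m - n : ℤ) : ℂ) * θ * I) := by
    intro θ
    have e1 : Complex.exp (((m - n : ℤ) : ℂ) * θ * I) =
      Complex.exp (m * θ * I) * Complex.exp (-(n * θ * I)) := by
      rw [← Complex.exp_add]; congr 1; push_cast; ring
    have e2 : Complex.exp (((-m - n : ℤ) : ℂ) * θ * I) =
      (starRingEnd ℂ) (Complex.exp (m * θ * I)) * Complex.exp (-(n * θ * I)) := by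
      rw [← Complex.exp_conj, ← Complex.exp_add]; congr 1; simp; ring
    rw [e1, e2, Complex.re_eq_add_conj, map_mul]
    ring
  simp_rw [e]
  rw [intervalIntegral.integral_add, intervalIntegral.integral_const_mul,
    intervalIntegral.integral_const_mul, integral_exp_int_mul_I, integral_exp_int_mul_I]
  · have h1 : (-(m : ℤ) - n) ≠ 0 := by omega
    have h2 : ((m : ℤ) - n = 0) ↔ m = n := by omega
    simp only [h1, h2, if_false]
    split_ifs <;> ring
  · exact Continuous.intervalIntegrable (by fun_prop) _ _
  · exact Continuous.intervalIntegrable (by fun_prop) _ _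

open Complex in
lemma integral_normSq_trigPoly (N : ℕ) (b : ℕ → ℂ) :
    ∫ θ in (0 : ℝ)..2 * π, ‖∑ n ∈ Finset.range N, b n * Complex.exp (n * θ * I)‖ ^ 2
      = 2 * π * ∑ n ∈ Finset.range N, ‖b n‖ ^ 2 := by
  apply Complex.ofReal_injective
  rw [← intervalIntegral.integral_ofReal]
  have e : ∀ θ : ℝ, ((‖∑ n ∈ Finset.range N, b n * Complex.exp (n * θ * I)‖ ^ 2 : ℝ) : ℂ) =
      ∑ m ∈ Finset.range N, ∑ n ∈ Finset.range N,
        b m * (starRingEnd ℂ) (b n) * Complex.exp (((m - n : ℤ) : ℂ) * θ * I) := by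
    intro θ
    rw [Complex.ofReal_pow, ← Complex.mul_conj', map_sum, Finset.sum_mul_sum]
    refine Finset.sum_congr rfl fun m _ => Finset.sum_congr rfl fun n _ => ?_
    have e1 : Complex.exp (((m - n : ℤ) : ℂ) * θ * I) =
        Complex.exp (m * θ * I) * (starRingEnd ℂ) (Complex.exp (n * θ * I)) := by
      rw [← Complex.exp_conj, ← Complex.exp_add]; congr 1; simp; ring
    rw [e1, map_mul]
    ring
  simp_rw [e]
  rw [intervalIntegral.integral_finsetSum]
  · have : ∀ m ∈ Finset.range N, ∫ θ in (0 : ℝ)..2 * π, ∑ n ∈ Finset.range N,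
        b m * (starRingEnd ℂ) (b n) * Complex.exp (((m - n : ℤ) : ℂ) * θ * I)
        = 2 * π * (‖b m‖ ^ 2 : ℝ) := by
      intro m hm
      rw [intervalIntegral.integral_finsetSum]
      · have h0 : ∀ n : ℕ, ((m : ℤ) - n = 0) ↔ m = n := fun n => by omega
        simp_rw [intervalIntegral.integral_const_mul, integral_exp_int_mul_I, h0]
        simp only [mul_ite, mul_zero, Finset.sum_ite_eq, hm, if_true]
        rw [Complex.mul_conj']
        push_cast; ring
      · intro n _
        exact Continuous.intervalIntegrable (by fun_prop) _ _
    rw [Finset.sum_congr rfl this, ← Finset.mul_sum]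
    push_cast
    rfl
  · intro m _
    exact Continuous.intervalIntegrable (by fun_prop) _ _

open Complex in
lemma integral_ball_normSq_polynomial (N : ℕ) (b : ℕ → ℂ) :
    ∫ z in ball (0 : ℂ) 1, ‖∑ n ∈ Finset.range N, b n * z ^ n‖ ^ 2
      = π * ∑ n ∈ Finset.range N, ‖b n‖ ^ 2 / (n + 1) := by
  set g : ℂ → ℝ := fun z => ‖∑ n ∈ Finset.range N, b n * z ^ n‖ ^ 2 with hg
  have hgc : Continuous g := by fun_prop
  have hsymm : Continuous fun p : ℝ × ℝ => Complex.polarCoord.symm p := by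
    simp only [Complex.polarCoord_symm_apply]
    fun_prop
  rw [← integral_indicator measurableSet_ball, ← Complex.integral_comp_polarCoord_symm]
  have hset : polarCoord.target ∩ (Set.Ioo (0 : ℝ) 1 ×ˢ Set.Ioo (-π) π)
      = Set.Ioo (0 : ℝ) 1 ×ˢ Set.Ioo (-π) π := by
    ext ⟨r, θ⟩
    simp [polarCoord]
    tauto
  have h1 : ∫ p in polarCoord.target, p.1 • (ball (0 : ℂ) 1).indicator g (Complex.polarCoord.symm p)
      = ∫ p in Set.Ioo (0 : ℝ) 1 ×ˢ Set.Ioo (-π) π, p.1 * g (Complex.polarCoord.symm p) := by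
    rw [← hset, ← setIntegral_indicator (measurableSet_Ioo.prod measurableSet_Ioo)]
    refine setIntegral_congr_fun polarCoord.open_target.measurableSet ?_
    rintro ⟨r, θ⟩ hp
    have hp' : 0 < r ∧ (-π < θ ∧ θ < π) := by simpa [polarCoord] using hp
    by_cases hr : r < 1
    · beta_reduce
      rw [Set.indicator_of_mem, Set.indicator_of_mem]
      · rfl
      · exact ⟨⟨hp'.1, hr⟩, hp'.2⟩
      · simpa [Complex.norm_polarCoord_symm, abs_of_pos hp'.1] using hr
    · beta_reduce
      rw [Set.indicator_of_notMem, Set.indicator_of_notMem]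
      · simp
      · exact fun h => hr h.1.2
      · simpa [Complex.norm_polarCoord_symm, abs_of_pos hp'.1] using hr
  rw [h1, Measure.volume_eq_prod, setIntegral_prod]
  · have h2 : ∀ r ∈ Set.Ioo (0 : ℝ) 1, ∫ θ in Set.Ioo (-π) π, r * g (Complex.polarCoord.symm (r, θ))
        = 2 * π * ∑ n ∈ Finset.range N, ‖b n‖ ^ 2 * r ^ (2 * n + 1) := by
      intro r hr
      rw [integral_const_mul, ← integral_Ioc_eq_integral_Ioo,
        ← intervalIntegral.integral_of_le (by linarith [pi_pos])]
      have e : ∀ θ : ℝ, g (Complex.polarCoord.symm (r, θ)) =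
          ‖∑ n ∈ Finset.range N, (b n * r ^ n) * Complex.exp (n * θ * I)‖ ^ 2 := by
        intro θ
        simp only [hg, Complex.polarCoord_symm_apply]
        congr 2
        refine Finset.sum_congr rfl fun n _ => ?_
        rw [mul_assoc (n : ℂ), Complex.exp_nat_mul, Complex.exp_mul_I]
        push_cast
        rw [mul_pow]
        ring
      simp_rw [e]
      have hper : Function.Periodic (fun θ : ℝ =>
          ‖∑ n ∈ Finset.range N, (b n * r ^ n) * Complex.exp (n * θ * I)‖ ^ 2) (2 * π) := by
        intro θ
        simp only
        congr 2
        refine Finset.sum_congr rfl fun n _ => ?_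
        congr 1
        rw [Complex.exp_eq_exp_iff_exists_int]
        exact ⟨n, by push_cast; ring⟩
      have := hper.intervalIntegral_add_eq (-π) 0
      rw [show -π + 2 * π = π by ring, zero_add] at this
      rw [this, integral_normSq_trigPoly, ← mul_assoc, mul_comm r, mul_assoc, Finset.mul_sum]
      congr 1
      refine Finset.sum_congr rfl fun n _ => ?_
      rw [norm_mul, norm_pow, Complex.norm_real, Real.norm_eq_abs, abs_of_pos hr.1]
      ring
    rw [setIntegral_congr_fun measurableSet_Ioo h2, ← integral_Ioc_eq_integral_Ioo,
      ← intervalIntegral.integral_of_le zero_le_one, intervalIntegral.integral_const_mul,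
      intervalIntegral.integral_finsetSum]
    · rw [mul_comm 2 π, mul_assoc, Finset.mul_sum]
      congr 1
      refine Finset.sum_congr rfl fun n _ => ?_
      rw [intervalIntegral.integral_const_mul, integral_pow]
      have : (n : ℝ) + 1 ≠ 0 := by positivity
      simp
      field_simp
      ring
    · intro n _
      exact Continuous.intervalIntegrable (by fun_prop) _ _
  · have : IntegrableOn (fun p : ℝ × ℝ => p.1 * g (Complex.polarCoord.symm p))
        (Set.Icc (0 : ℝ) 1 ×ˢ Set.Icc (-π) π) := by
      refine ContinuousOn.integrableOn_compact (isCompact_Icc.prod isCompact_Icc) ?_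
      exact (continuous_fst.mul (hgc.comp hsymm)).continuousOn
    exact this.mono_set (Set.prod_mono Set.Ioo_subset_Icc_self Set.Ioo_subset_Icc_self)

open Filter Topology in
lemma integral_ball_normSq_deriv_le {F : ℂ → ℂ} (hF : DifferentiableOn ℂ F (ball 0 1)) {K : ℝ}
    (hK : ∀ N : ℕ, π * ∑ n ∈ Finset.range N,
      (n + 1) * ‖iteratedDeriv (n + 1) F 0 / (n + 1).factorial‖ ^ 2 ≤ K) :
    ∫ z in ball (0 : ℂ) 1, ‖deriv F z‖ ^ 2 ≤ K := by
  have hK0 : 0 ≤ K := by simpa using hK 0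
  have hF' : DifferentiableOn ℂ (deriv F) (ball 0 1) := hF.deriv isOpen_ball
  set b : ℕ → ℂ := fun n => (n + 1) * (iteratedDeriv (n + 1) F 0 / (n + 1).factorial) with hb
  set P : ℕ → ℂ → ℝ := fun N z => ‖∑ n ∈ Finset.range N, b n * z ^ n‖ ^ 2 with hP
  have hPc : ∀ N, Continuous (P N) := fun N => by fun_prop
  have hlim : ∀ z ∈ ball (0 : ℂ) 1, Tendsto (fun N => P N z) atTop (𝓝 (‖deriv F z‖ ^ 2)) := by
    intro z hz
    have := (Complex.hasSum_taylorSeries_on_ball hF' hz).tendsto_sum_nat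
    refine ((this.congr fun N => ?_).norm).pow 2
    refine Finset.sum_congr rfl fun n _ => ?_
    have h1 : ((n : ℂ) + 1) ≠ 0 := by exact_mod_cast n.succ_ne_zero
    have h2 : (n.factorial : ℂ) ≠ 0 := by exact_mod_cast n.factorial_ne_zero
    simp only [hb, sub_zero, smul_eq_mul, ← iteratedDeriv_succ', Nat.factorial_succ]
    push_cast
    field_simp
  have hPint : ∀ N, ∫⁻ z in ball (0 : ℂ) 1, ENNReal.ofReal (P N z) ≤ ENNReal.ofReal K := by
    intro N
    rw [← ofReal_integral_eq_lintegral_ofReal]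
    · refine ENNReal.ofReal_le_ofReal ?_
      refine le_of_eq_of_le ?_ (hK N)
      rw [integral_ball_normSq_polynomial]
      congr 1
      refine Finset.sum_congr rfl fun n _ => ?_
      have h1 : ((n : ℝ) + 1) ≠ 0 := by positivity
      have h3 : ‖((n : ℂ) + 1)‖ = n + 1 := by exact_mod_cast Complex.norm_natCast (n + 1)
      simp only [hb]
      rw [norm_mul, h3]
      field_simp
    · exact ((hPc N).continuousOn.integrableOn_compact (isCompact_closedBall 0 1)).mono_set
        ball_subset_closedBall
    · exact ae_of_all _ fun z => by positivity
  rw [integral_eq_lintegral_of_nonneg_ae (ae_of_all _ fun z => by positivity)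
    (ContinuousOn.aestronglyMeasurable (f := fun z => ‖deriv F z‖ ^ 2)
      (hF'.continuousOn.norm.pow 2) measurableSet_ball)]
  refine ENNReal.toReal_le_of_le_ofReal hK0 ?_
  calc ∫⁻ z in ball (0 : ℂ) 1, ENNReal.ofReal (‖deriv F z‖ ^ 2)
      = ∫⁻ z in ball (0 : ℂ) 1, liminf (fun N => ENNReal.ofReal (P N z)) atTop := by
        refine setLIntegral_congr_fun measurableSet_ball fun z hz => ?_
        exact ((ENNReal.continuous_ofReal.tendsto _).comp (hlim z hz)).liminf_eq.symm
    _ ≤ liminf (fun N => ∫⁻ z in ball (0 : ℂ) 1, ENNReal.ofReal (P N z)) atTop :=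
        lintegral_liminf_le fun N => ((hPc N).measurable).ennreal_ofReal
    _ ≤ ENNReal.ofReal K :=
        liminf_le_of_le (by isBoundedDefault) fun a ha => by
          obtain ⟨N, hN⟩ := ha.exists
          exact hN.trans (hPint N)

lemma intervalIntegral_green {U Ux Uy hx hy hxx : ℝ → ℝ → ℝ} {a L : ℝ}
    (hU : Continuous (Function.uncurry U)) (hUx : Continuous (Function.uncurry Ux))
    (hUy : Continuous (Function.uncurry Uy)) (hhx : Continuous (Function.uncurry hx))
    (hhy : Continuous (Function.uncurry hy)) (hhxx : Continuous (Function.uncurry hxx))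
    (dUx : ∀ x y, HasDerivAt (fun x => U x y) (Ux x y) x)
    (dUy : ∀ x y, HasDerivAt (fun y => U x y) (Uy x y) y)
    (dhxx : ∀ x y, HasDerivAt (fun x => hx x y) (hxx x y) x)
    (dhyy : ∀ x y, HasDerivAt (fun y => hy x y) (-hxx x y) y)
    (pU : ∀ y, U a y = U 0 y) (ph : ∀ y, hx a y = hx 0 y) (h0 : ∀ x, hy x 0 = 0) :
    ∫ x in (0 : ℝ)..a, ∫ y in (0 : ℝ)..L, (Ux x y * hx x y + Uy x y * hy x y)
      = ∫ x in (0 : ℝ)..a, U x L * hy x L := by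
  have c1 : ∀ {V : ℝ → ℝ → ℝ}, Continuous (Function.uncurry V) → ∀ x, Continuous (V x) :=
    fun hV x => hV.comp (Continuous.prodMk_right x)
  have c2 : ∀ {V : ℝ → ℝ → ℝ}, Continuous (Function.uncurry V) → ∀ y, Continuous (fun x => V x y) :=
    fun hV y => hV.comp (Continuous.prodMk_left y)
  have cA : Continuous (Function.uncurry fun x y => Ux x y * hx x y + U x y * hxx x y) :=
    (hUx.mul hhx).add (hU.mul hhxx)
  have cB : Continuous (Function.uncurry fun x y => Uy x y * hy x y + U x y * -hxx x y) :=
    (hUy.mul hhy).add (hU.mul hhxx.neg)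
  have hA : ∫ x in (0 : ℝ)..a, ∫ y in (0 : ℝ)..L, (Ux x y * hx x y + U x y * hxx x y) = 0 := by
    rw [intervalIntegral_intervalIntegral_swap]
    · have : ∀ y, ∫ x in (0 : ℝ)..a, (Ux x y * hx x y + U x y * hxx x y) = 0 := by
        intro y
        rw [intervalIntegral.integral_deriv_mul_eq_sub (fun x _ => dUx x y) (fun x _ => dhxx x y)
          ((c2 hUx y).intervalIntegrable _ _) ((c2 hhxx y).intervalIntegrable _ _), pU, ph, sub_self]
      simp [this]
    · exact (cA.continuousOn.integrableOn_compact (isCompact_uIcc.prod isCompact_uIcc)).mono_set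
        (Set.prod_mono Set.uIoc_subset_uIcc Set.uIoc_subset_uIcc)
  have hB : ∀ x, ∫ y in (0 : ℝ)..L, (Uy x y * hy x y + U x y * -hxx x y) = U x L * hy x L := by
    intro x
    rw [intervalIntegral.integral_deriv_mul_eq_sub (fun y _ => dUy x y) (fun y _ => dhyy x y)
      ((c1 hUy x).intervalIntegrable _ _) ((c1 hhxx x).neg.intervalIntegrable _ _), h0]
    simp
  have hsplit : ∀ x, ∫ y in (0 : ℝ)..L, (Ux x y * hx x y + Uy x y * hy x y) =
      (∫ y in (0 : ℝ)..L, (Ux x y * hx x y + U x y * hxx x y)) + U x L * hy x L := by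
    intro x
    rw [← hB, ← intervalIntegral.integral_add ((c1 cA x).intervalIntegrable _ _)
      ((c1 cB x).intervalIntegrable _ _)]
    congr 1
    ext y
    ring
  simp_rw [hsplit]
  rw [intervalIntegral.integral_add, hA, zero_add]
  · exact (intervalIntegral.continuous_parametric_intervalIntegral_of_continuous' cA _
      _).intervalIntegrable _ _
  · exact ((c2 hU L).mul (c2 hhy L)).intervalIntegrable _ _

lemma dirichlet_energy_ge {U Ux Uy h hx hy hxx : ℝ → ℝ → ℝ} {a L : ℝ} (ha : 0 ≤ a) (hL : 0 ≤ L)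
    (hU : Continuous (Function.uncurry U)) (hUx : Continuous (Function.uncurry Ux))
    (hUy : Continuous (Function.uncurry Uy)) (hh : Continuous (Function.uncurry h))
    (hhx : Continuous (Function.uncurry hx))
    (hhy : Continuous (Function.uncurry hy)) (hhxx : Continuous (Function.uncurry hxx))
    (dUx : ∀ x y, HasDerivAt (fun x => U x y) (Ux x y) x)
    (dUy : ∀ x y, HasDerivAt (fun y => U x y) (Uy x y) y)
    (dhx : ∀ x y, HasDerivAt (fun x => h x y) (hx x y) x)
    (dhy : ∀ x y, HasDerivAt (fun y => h x y) (hy x y) y)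
    (dhxx : ∀ x y, HasDerivAt (fun x => hx x y) (hxx x y) x)
    (dhyy : ∀ x y, HasDerivAt (fun y => hy x y) (-hxx x y) y)
    (pU : ∀ y, U a y = U 0 y) (ph : ∀ y, h a y = h 0 y) (phx : ∀ y, hx a y = hx 0 y)
    (h0 : ∀ x, hy x 0 = 0) :
    2 * (∫ x in (0 : ℝ)..a, U x L * hy x L) - ∫ x in (0 : ℝ)..a, h x L * hy x L
      ≤ ∫ x in (0 : ℝ)..a, ∫ y in (0 : ℝ)..L, (Ux x y ^ 2 + Uy x y ^ 2) := by
  have c1 : ∀ {V : ℝ → ℝ → ℝ}, Continuous (Function.uncurry V) → ∀ x, Continuous (V x) :=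
    fun hV x => hV.comp (Continuous.prodMk_right x)
  have ci : ∀ {V : ℝ → ℝ → ℝ}, Continuous (Function.uncurry V) →
      IntervalIntegrable (fun x => ∫ y in (0 : ℝ)..L, V x y) volume 0 a := fun hV =>
    (intervalIntegral.continuous_parametric_intervalIntegral_of_continuous' hV _
      _).intervalIntegrable _ _
  have cA : Continuous (Function.uncurry fun x y => Ux x y * hx x y + Uy x y * hy x y) :=
    (hUx.mul hhx).add (hUy.mul hhy)
  have cB : Continuous (Function.uncurry fun x y => hx x y * hx x y + hy x y * hy x y) :=
    (hhx.mul hhx).add (hhy.mul hhy)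
  have cE : Continuous (Function.uncurry fun x y => Ux x y ^ 2 + Uy x y ^ 2) :=
    (hUx.pow 2).add (hUy.pow 2)
  rw [← intervalIntegral_green hU hUx hUy hhx hhy hhxx dUx dUy dhxx dhyy pU phx h0,
    ← intervalIntegral_green hh hhx hhy hhx hhy hhxx dhx dhy dhxx dhyy ph phx h0,
    ← intervalIntegral.integral_const_mul, ← intervalIntegral.integral_sub ((ci cA).const_mul 2)
      (ci cB)]
  refine intervalIntegral.integral_mono_on ha (((ci cA).const_mul 2).sub (ci cB)) (ci cE)
    fun x _ => ?_
  have i1 := ((c1 cA x).intervalIntegrable (μ := volume) 0 L).const_mul 2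
  have i2 := (c1 cB x).intervalIntegrable (μ := volume) 0 L
  rw [← intervalIntegral.integral_const_mul, ← intervalIntegral.integral_sub i1 i2]
  refine intervalIntegral.integral_mono_on hL (i1.sub i2)
    ((c1 cE x).intervalIntegrable _ _) fun y _ => ?_
  nlinarith [sq_nonneg (Ux x y - hx x y), sq_nonneg (Uy x y - hy x y)]

open Complex in
lemma hasDerivAt_re_mul_exp (n : ℕ) (d : ℂ) (x : ℝ) :
    HasDerivAt (fun x : ℝ => (d * Complex.exp (n * x * I)).re)
      ((d * (n * I)) * Complex.exp (n * x * I)).re x := by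
  have h1 : HasDerivAt (fun x : ℝ => (n * x * I : ℂ)) (n * I) x := by
    simpa using ((Complex.ofRealCLM.hasDerivAt (x := x)).const_mul (n : ℂ)).mul_const I
  have h2 := Complex.reCLM.hasFDerivAt.comp_hasDerivAt x (h1.cexp.const_mul d)
  refine HasDerivAt.congr_deriv (f := fun x : ℝ => (d * Complex.exp (n * x * I)).re) h2 ?_
  simp only [Complex.reCLM_apply]
  congr 1
  ring

open Complex in
lemma energy_ge_sum_tanh {U Ux Uy : ℝ → ℝ → ℝ} {L : ℝ} (hL : 0 ≤ L)
    (hU : Continuous (Function.uncurry U)) (hUx : Continuous (Function.uncurry Ux))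
    (hUy : Continuous (Function.uncurry Uy))
    (dUx : ∀ x y, HasDerivAt (fun x => U x y) (Ux x y) x)
    (dUy : ∀ x y, HasDerivAt (fun y => U x y) (Uy x y) y)
    (pU : ∀ y, U (2 * π) y = U 0 y) {c : ℕ → ℂ}
    (hc : ∀ n : ℕ, ∫ θ in (0 : ℝ)..2 * π, (U θ L : ℂ) * Complex.exp (-((n + 1 : ℕ) * θ * I))
      = π * c n) (N : ℕ) :
    π * ∑ n ∈ Finset.range N, (n + 1) * Real.tanh ((n + 1) * L) * ‖c n‖ ^ 2
      ≤ ∫ x in (0 : ℝ)..2 * π, ∫ y in (0 : ℝ)..L, (Ux x y ^ 2 + Uy x y ^ 2) := by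
  set φ : ℕ → ℂ → ℝ → ℝ := fun n d x => (d * Complex.exp ((n + 1 : ℕ) * x * I)).re with hφ
  have φc : ∀ n d, Continuous (φ n d) := fun n d => by fun_prop
  have φd : ∀ n d x, HasDerivAt (φ n d) (φ n (d * ((n + 1 : ℕ) * I)) x) x :=
    fun n d x => hasDerivAt_re_mul_exp (n + 1) d x
  have φp : ∀ n d, φ n d (2 * π) = φ n d 0 := by
    intro n d
    simp only [hφ]
    congr 2
    rw [Complex.exp_eq_exp_iff_exists_int]
    exact ⟨n + 1, by push_cast; ring⟩
  have φ2 : ∀ n d x, φ n (d * ((n + 1 : ℕ) * I) * ((n + 1 : ℕ) * I)) x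
      = -((n + 1 : ℝ) ^ 2 * φ n d x) := by
    intro n d x
    simp only [hφ]
    rw [show d * ((n + 1 : ℕ) * I) * ((n + 1 : ℕ) * I) * Complex.exp ((n + 1 : ℕ) * x * I) =
      ((-(n + 1 : ℝ) ^ 2 : ℝ) : ℂ) * (d * Complex.exp ((n + 1 : ℕ) * x * I)) by
        push_cast; linear_combination
          (d * ((n : ℂ) + 1) ^ 2 * Complex.exp ((n + 1) * x * I)) * I_sq, Complex.re_ofReal_mul]
    ring
  set A : ℕ → ℝ → ℝ := fun n y => Real.cosh ((n + 1) * y) / Real.cosh ((n + 1) * L) with hA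
  set B : ℕ → ℝ → ℝ := fun n y => (n + 1) * Real.sinh ((n + 1) * y) / Real.cosh ((n + 1) * L)
    with hB
  have Ac : ∀ n, Continuous (A n) := fun n => by fun_prop
  have Bc : ∀ n, Continuous (B n) := fun n => by fun_prop
  have dlin : ∀ (n : ℕ) (y : ℝ), HasDerivAt (fun y : ℝ => ((n : ℝ) + 1) * y) ((n : ℝ) + 1) y :=
    fun n y => by simpa using (hasDerivAt_id y).const_mul ((n : ℝ) + 1)
  have dA : ∀ n y, HasDerivAt (A n) (B n y) y := by
    intro n y
    refine ((dlin n y).cosh.div_const (Real.cosh ((n + 1) * L))).congr_deriv ?_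
    simp only [hB]
    ring
  have dB : ∀ n y, HasDerivAt (B n) ((n + 1) ^ 2 * A n y) y := by
    intro n y
    refine (((dlin n y).sinh.const_mul ((n : ℝ) + 1)).div_const
      (Real.cosh ((n + 1) * L))).congr_deriv ?_
    simp only [hA]
    ring
  have AL : ∀ n, A n L = 1 := fun n => div_self (Real.cosh_pos _).ne'
  have BL : ∀ n, B n L = (n + 1) * Real.tanh ((n + 1) * L) := fun n => by
    simp only [hB, Real.tanh_eq_sinh_div_cosh]; ring
  have cont : ∀ (T : ℕ → ℝ → ℝ) (d : ℕ → ℂ), (∀ n, Continuous (T n)) →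
      Continuous (Function.uncurry fun x y => ∑ n ∈ Finset.range N, T n y * φ n (d n) x) := by
    intro T d hT
    refine continuous_finsetSum _ fun n _ => ?_
    exact ((hT n).comp continuous_snd).mul ((φc n (d n)).comp continuous_fst)
  have pair : ∀ n d, ∫ θ in (0 : ℝ)..2 * π, U θ L * φ n d θ = π * ((starRingEnd ℂ) d * c n).re :=
    fun n d => integral_mul_re_of_fourier (hU.comp (Continuous.prodMk_left L)) (hc n) d
  have pair' : ∀ m n d e, ∫ θ in (0 : ℝ)..2 * π, φ m e θ * φ n d θ =
      π * ((starRingEnd ℂ) d * if m = n then e else 0).re := by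
    intro m n d e
    refine integral_mul_re_of_fourier (φc m e) ?_ d
    have := integral_re_mul_exp (m + 1) (n + 1) n.succ_pos e
    simpa [hφ] using this
  have key := dirichlet_energy_ge (U := U) (Ux := Ux) (Uy := Uy) (a := 2 * π) (L := L)
    (h := fun x y => ∑ n ∈ Finset.range N, A n y * φ n (c n) x)
    (hx := fun x y => ∑ n ∈ Finset.range N, A n y * φ n (c n * ((n + 1 : ℕ) * I)) x)
    (hy := fun x y => ∑ n ∈ Finset.range N, B n y * φ n (c n) x)
    (hxx := fun x y => ∑ n ∈ Finset.range N,
      A n y * φ n (c n * ((n + 1 : ℕ) * I) * ((n + 1 : ℕ) * I)) x)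
    (by positivity) hL hU hUx hUy (cont A _ Ac) (cont A _ Ac) (cont B _ Bc) (cont A _ Ac) dUx dUy
    (fun x y => HasDerivAt.fun_sum fun n _ => (φd n _ x).const_mul _)
    (fun x y => HasDerivAt.fun_sum fun n _ => (dA n y).mul_const _)
    (fun x y => HasDerivAt.fun_sum fun n _ => (φd n _ x).const_mul _)
    (fun x y => by
      rw [← Finset.sum_neg_distrib]
      refine HasDerivAt.fun_sum fun n _ => ?_
      rw [φ2]
      exact ((dB n y).mul_const (φ n (c n) x)).congr_deriv (by ring))
    pU (fun y => by simp only [φp]) (fun y => by simp only [φp])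
    (fun x => by simp [hB])
  refine le_trans (le_of_eq ?_) key
  have e1 : ∫ x in (0 : ℝ)..2 * π, U x L * ∑ n ∈ Finset.range N, B n L * φ n (c n) x
      = π * ∑ n ∈ Finset.range N, B n L * ‖c n‖ ^ 2 := by
    simp_rw [Finset.mul_sum, mul_left_comm (U _ L)]
    rw [intervalIntegral.integral_finsetSum]
    · refine Finset.sum_congr rfl fun n _ => ?_
      rw [intervalIntegral.integral_const_mul, pair, Complex.conj_mul', ← Complex.ofReal_pow,
        Complex.ofReal_re]
      ring
    · intro n _
      exact (continuous_const.mul ((hU.comp (Continuous.prodMk_left L)).mul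
        (φc n _))).intervalIntegrable _ _
  have e2 : ∫ x in (0 : ℝ)..2 * π, (∑ n ∈ Finset.range N, A n L * φ n (c n) x) *
      ∑ n ∈ Finset.range N, B n L * φ n (c n) x
      = π * ∑ n ∈ Finset.range N, B n L * ‖c n‖ ^ 2 := by
    simp_rw [AL, one_mul, Finset.sum_mul_sum, mul_left_comm (φ _ _ _)]
    rw [intervalIntegral.integral_finsetSum]
    · rw [Finset.mul_sum]
      refine Finset.sum_congr rfl fun m hm => ?_
      rw [intervalIntegral.integral_finsetSum]
      · simp_rw [intervalIntegral.integral_const_mul, pair']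
        rw [Finset.sum_eq_single m]
        · rw [if_pos rfl, Complex.conj_mul', ← Complex.ofReal_pow, Complex.ofReal_re]
          ring
        · intro n _ hn
          simp [hn.symm]
        · exact fun h => absurd hm h
      · intro n _
        exact (continuous_const.mul ((φc m _).mul (φc n _))).intervalIntegrable _ _
    · intro m _
      refine Continuous.intervalIntegrable (continuous_finsetSum _ fun n _ => ?_) _ _
      exact continuous_const.mul ((φc m _).mul (φc n _))
  rw [e1, e2]
  simp_rw [BL]
  ring

lemma pt_eq (a b : ℝ) : pt a b = a • pt 1 0 + b • pt 0 1 := by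
  ext i; fin_cases i <;> simp [pt]

lemma continuous_pt : Continuous (Function.uncurry pt) := by
  have : Function.uncurry pt = fun p : ℝ × ℝ => p.1 • pt 1 0 + p.2 • pt 0 1 := by
    ext1 p; exact pt_eq _ _
  rw [this]; fun_prop

lemma hasDerivAt_pt_left (x y : ℝ) : HasDerivAt (fun x => pt x y) (pt 1 0) x := by
  simp_rw [pt_eq _ y]
  simpa using ((hasDerivAt_id x).smul_const (pt 1 0)).add_const (y • pt 0 1)

lemma hasDerivAt_pt_right (x y : ℝ) : HasDerivAt (fun y => pt x y) (pt 0 1) y := by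
  simp_rw [pt_eq x]
  simpa using ((hasDerivAt_id y).smul_const (pt 0 1)).const_add (x • pt 1 0)

lemma norm_pt_sq (a b : ℝ) : ‖pt a b‖ ^ 2 = a ^ 2 + b ^ 2 := by
  simp [EuclideanSpace.norm_sq_eq, pt]

lemma sq_add_sq_le_opNorm_sq (A : E2 →L[ℝ] ℝ) :
    A (pt 1 0) ^ 2 + A (pt 0 1) ^ 2 ≤ ‖A‖ ^ 2 := by
  set a := A (pt 1 0)
  set b := A (pt 0 1)
  have h : A (pt a b) = a ^ 2 + b ^ 2 := by
    rw [pt_eq, map_add, map_smul, map_smul, smul_eq_mul, smul_eq_mul, sq, sq]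
  have h1 := A.le_opNorm (pt a b)
  rw [h, Real.norm_of_nonneg (by positivity), ← norm_pt_sq, sq] at h1
  rw [← norm_pt_sq]
  rcases (norm_nonneg (pt a b)).eq_or_lt with h0 | h0
  · rw [← h0, zero_pow two_ne_zero]; positivity
  · exact pow_le_pow_left₀ h0.le (le_of_mul_le_mul_right h1 h0) 2

def prodMeasurableEquiv : ℝ × ℝ ≃ᵐ E2 :=
  MeasurableEquiv.finTwoArrow.symm.trans (MeasurableEquiv.toLp 2 (Fin 2 → ℝ))

lemma prodMeasurableEquiv_apply (p : ℝ × ℝ) : prodMeasurableEquiv p = pt p.1 p.2 := by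
  ext i; fin_cases i <;> simp [prodMeasurableEquiv, pt, MeasurableEquiv.finTwoArrow]

lemma measurePreserving_prodMeasurableEquiv : MeasurePreserving prodMeasurableEquiv :=
  (PiLp.volume_preserving_toLp (Fin 2)).comp (volume_preserving_finTwoArrow ℝ).symm

lemma setIntegral_rectangle {f : E2 → ℝ} (hf : Continuous f) {a b : ℝ} (ha : 0 ≤ a) (hb : 0 ≤ b) :
    ∫ x in {x : E2 | x 0 ∈ Set.Icc 0 a ∧ x 1 ∈ Set.Icc 0 b}, f x
      = ∫ x in (0 : ℝ)..a, ∫ y in (0 : ℝ)..b, f (pt x y) := by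
  rw [← measurePreserving_prodMeasurableEquiv.setIntegral_preimage_emb
    prodMeasurableEquiv.measurableEmbedding]
  have : prodMeasurableEquiv ⁻¹' {x : E2 | x 0 ∈ Set.Icc 0 a ∧ x 1 ∈ Set.Icc 0 b} =
      Set.Icc 0 a ×ˢ Set.Icc 0 b := by
    ext p
    simp [prodMeasurableEquiv_apply, pt, -Set.Icc_prod_Icc]
  simp_rw [this, prodMeasurableEquiv_apply]
  have hc : Continuous fun p : ℝ × ℝ => f (pt p.1 p.2) := hf.comp continuous_pt
  rw [Measure.volume_eq_prod, setIntegral_prod _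
    (hc.continuousOn.integrableOn_compact (isCompact_Icc.prod isCompact_Icc)),
    integral_Icc_eq_integral_Ioc, intervalIntegral.integral_of_le ha]
  simp_rw [integral_Icc_eq_integral_Ioc, intervalIntegral.integral_of_le hb]

lemma integral_partials_le_energy {u : E2 → ℝ} (hu : ContDiff ℝ 1 u) {a b : ℝ} (ha : 0 ≤ a)
    (hb : 0 ≤ b) :
    ∫ x in (0 : ℝ)..a, ∫ y in (0 : ℝ)..b,
        (fderiv ℝ u (pt x y) (pt 1 0) ^ 2 + fderiv ℝ u (pt x y) (pt 0 1) ^ 2)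
      ≤ ∫ x in {x : E2 | x 0 ∈ Set.Icc 0 a ∧ x 1 ∈ Set.Icc 0 b}, ‖fderiv ℝ u x‖ ^ 2 := by
  have hd : Continuous (fderiv ℝ u) := hu.continuous_fderiv one_ne_zero
  rw [setIntegral_rectangle (f := fun x => ‖fderiv ℝ u x‖ ^ 2) (hd.norm.pow 2) ha hb]
  have c1 : Continuous (Function.uncurry fun x y =>
      fderiv ℝ u (pt x y) (pt 1 0) ^ 2 + fderiv ℝ u (pt x y) (pt 0 1) ^ 2) :=
    (((hd.comp continuous_pt).clm_apply continuous_const).pow 2).add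
      (((hd.comp continuous_pt).clm_apply continuous_const).pow 2)
  have c2 : Continuous (Function.uncurry fun x y => ‖fderiv ℝ u (pt x y)‖ ^ 2) :=
    (hd.comp continuous_pt).norm.pow 2
  refine intervalIntegral.integral_mono_on ha
    ((intervalIntegral.continuous_parametric_intervalIntegral_of_continuous' c1 _
      _).intervalIntegrable _ _)
    ((intervalIntegral.continuous_parametric_intervalIntegral_of_continuous' c2 _
      _).intervalIntegrable _ _) fun x _ => ?_
  exact intervalIntegral.integral_mono_on hb
    ((c1.comp (Continuous.prodMk_right x)).intervalIntegrable _ _)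
    ((c2.comp (Continuous.prodMk_right x)).intervalIntegrable _ _)
    fun y _ => sq_add_sq_le_opNorm_sq _

/-- The standard identification of the complex plane with the Euclidean plane. -/
def complexToE2 : ℂ ≃ₗᵢ[ℝ] E2 := Complex.orthonormalBasisOneI.repr

lemma complexToE2_apply (z : ℂ) : complexToE2 z = pt z.re z.im := by
  ext i; fin_cases i <;> simp [complexToE2, pt]

lemma complexToE2_circleMap (θ : ℝ) : complexToE2 (circleMap 0 1 θ) = pt (cos θ) (sin θ) := by
  rw [complexToE2_apply]
  simp [circleMap, Complex.exp_ofReal_mul_I_re, Complex.exp_ofReal_mul_I_im]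

lemma complexToE2_preimage_ball : complexToE2 ⁻¹' ball 0 1 = ball 0 1 := by
  simp

lemma complexToE2_preimage_closedBall : complexToE2 ⁻¹' closedBall 0 1 = closedBall 0 1 := by
  simp

lemma setIntegral_ball_comp_complexToE2 (f : E2 → ℝ) :
    ∫ z in ball (0 : ℂ) 1, f (complexToE2 z) = ∫ x in ball (0 : E2) 1, f x := by
  rw [← complexToE2_preimage_ball]
  exact complexToE2.measurePreserving.setIntegral_preimage_emb
    complexToE2.toMeasurableEquiv.measurableEmbedding f _

lemma norm_fderiv_comp_complexToE2 (v : E2 → ℝ) (z : ℂ) :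
    ‖fderiv ℝ (v ∘ complexToE2) z‖ = ‖fderiv ℝ v (complexToE2 z)‖ := by
  have := complexToE2.toContinuousLinearEquiv.comp_right_fderiv (f := v) (x := z)
  rw [show (v ∘ complexToE2) = v ∘ complexToE2.toContinuousLinearEquiv from rfl, this]
  exact ContinuousLinearMap.opNorm_comp_linearIsometryEquiv _ complexToE2

lemma norm_fderiv_re {F : ℂ → ℂ} {z : ℂ} (hF : DifferentiableAt ℂ F z) :
    ‖fderiv ℝ (fun z => (F z).re) z‖ = ‖deriv F z‖ := by
  have h1 : HasFDerivAt (fun z => (F z).re) (Complex.reCLM.comp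
      ((ContinuousLinearMap.toSpanSingleton ℂ (deriv F z)).restrictScalars ℝ)) z :=
    Complex.reCLM.hasFDerivAt.comp z (hF.hasDerivAt.hasFDerivAt.restrictScalars ℝ)
  rw [h1.fderiv]
  set A := Complex.reCLM.comp
      ((ContinuousLinearMap.toSpanSingleton ℂ (deriv F z)).restrictScalars ℝ)
  have hA : ∀ w, A w = (w * deriv F z).re := fun w => by simp [A]
  refine le_antisymm (A.opNorm_le_bound (norm_nonneg _) fun w => ?_) ?_
  · rw [hA, mul_comm, ← norm_mul]
    exact Complex.abs_re_le_norm _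
  · have h := A.le_opNorm (starRingEnd ℂ (deriv F z))
    rw [hA, Complex.conj_mul', ← Complex.ofReal_pow, Complex.ofReal_re,
      Real.norm_of_nonneg (by positivity), RCLike.norm_conj, sq] at h
    rcases (norm_nonneg (deriv F z)).eq_or_lt with h0 | h0
    · rw [← h0]; positivity
    · exact le_of_mul_le_mul_right h h0

open InnerProductSpace in
lemma laplacian_comp_complexToE2 {v : E2 → ℝ} {z : ℂ} (hv : ContDiffAt ℝ 2 v (complexToE2 z)) :
    Laplacian.laplacian (v ∘ complexToE2) z = lap v (complexToE2 z) := by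
  rw [laplacian_eq_iteratedFDeriv_orthonormalBasis _ Complex.orthonormalBasisOneI, lap]
  refine Finset.sum_congr rfl fun i _ => ?_
  have h1 := complexToE2.toContinuousLinearEquiv.iteratedFDerivWithin_comp_right v
    uniqueDiffOn_univ (Set.mem_univ (complexToE2 z)) 2
  rw [Set.preimage_univ, iteratedFDerivWithin_univ, iteratedFDerivWithin_univ] at h1
  have hd : DifferentiableAt ℝ (fderiv ℝ v) (complexToE2 z) :=
    (hv.fderiv_right (m := 1) le_rfl).differentiableAt one_ne_zero
  have hb : complexToE2 (Complex.orthonormalBasisOneI i) = EuclideanSpace.single i 1 :=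
    Complex.orthonormalBasisOneI.repr_self i
  have h2 : iteratedFDeriv ℝ 2 (v ∘ complexToE2) z ![Complex.orthonormalBasisOneI i,
      Complex.orthonormalBasisOneI i] = iteratedFDeriv ℝ 2 v (complexToE2 z) fun j =>
        complexToE2 (![Complex.orthonormalBasisOneI i, Complex.orthonormalBasisOneI i] j) :=
    DFunLike.congr_fun h1 _
  rw [h2, iteratedFDeriv_two_apply, fderiv_clm_apply hd (differentiableAt_const _)]
  simp [-Complex.coe_orthonormalBasisOneI, hb]

open InnerProductSpace in
lemma harmonicOnNhd_comp_complexToE2 {v : E2 → ℝ} (hv : ContDiffOn ℝ 2 v (ball 0 1))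
    (hl : ∀ x ∈ ball (0 : E2) 1, lap v x = 0) :
    HarmonicOnNhd (v ∘ complexToE2) (ball 0 1) := by
  have hm : ∀ z ∈ ball (0 : ℂ) 1, complexToE2 z ∈ ball (0 : E2) 1 := fun z hz => by
    rwa [← complexToE2_preimage_ball] at hz
  have hd : ∀ z ∈ ball (0 : ℂ) 1, ContDiffAt ℝ 2 v (complexToE2 z) := fun z hz =>
    hv.contDiffAt (isOpen_ball.mem_nhds (hm z hz))
  refine fun z hz => ⟨(hd z hz).comp z complexToE2.contDiff.contDiffAt, ?_⟩
  filter_upwards [isOpen_ball.mem_nhds hz] with w hw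
  rw [laplacian_comp_complexToE2 (hd w hw), hl _ (hm w hw), Pi.zero_apply]

lemma one_le_mul_tanh {L x : ℝ} (hL : (3 / 2) * Real.log 2 ≤ L) (hx : L ≤ x) :
    1 ≤ (1 + 3 * Real.exp (-2 * L)) * Real.tanh x := by
  have hq : Real.exp (-2 * L) ≤ 1 / 8 := by
    calc Real.exp (-2 * L) ≤ Real.exp (-((3 : ℕ) * Real.log 2)) :=
          Real.exp_le_exp.2 (by push_cast; linarith)
      _ = 1 / 8 := by
          rw [Real.exp_neg, Real.exp_nat_mul, Real.exp_log two_pos]; norm_num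
  have hb : Real.exp (-x) ≤ Real.exp (-2 * L) * Real.exp x := by
    rw [← Real.exp_add]
    exact Real.exp_le_exp.2 (by linarith)
  have ha := Real.exp_pos x
  have hb0 := Real.exp_pos (-x)
  have hq0 := Real.exp_pos (-2 * L)
  rw [Real.tanh_eq, mul_div_assoc', le_div_iff₀ (by positivity)]
  generalize Real.exp (-2 * L) = q at *
  generalize Real.exp x = a at *
  generalize Real.exp (-x) = b at *
  have h8 : b ≤ a / 8 := by nlinarith
  nlinarith [mul_nonneg hq0.le (sub_nonneg.2 h8), mul_pos hq0 ha]

theorem harmonic_extension_energy_bound :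
    ∃ C : ℝ, 0 < C ∧
      ∀ (L : ℝ), (3 / 2) * Real.log 2 ≤ L →
        ∀ u : E2 → ℝ, ContDiff ℝ 1 u →
          (∀ θ t : ℝ, u (pt (θ + 2 * Real.pi) t) = u (pt θ t)) →
          ∀ v : E2 → ℝ,
            ContinuousOn v (closedBall (0 : E2) 1) →
            ContDiffOn ℝ 2 v (ball (0 : E2) 1) →
            (∀ x ∈ ball (0 : E2) 1, lap v x = 0) →
            (∀ θ : ℝ, v (pt (Real.cos θ) (Real.sin θ)) = u (pt θ L)) →
            (∫ x in ball (0 : E2) 1, ‖fderiv ℝ v x‖ ^ 2)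
              ≤ (1 + C * Real.exp (-2 * L)) *
                ∫ x in {x : E2 | x 0 ∈ Set.Icc (0:ℝ) (2 * Real.pi) ∧
                    x 1 ∈ Set.Icc (0:ℝ) L}, ‖fderiv ℝ u x‖ ^ 2 := by
  refine ⟨3, by norm_num, fun L hL u hu hper v hv hv2 hlap hbd => ?_⟩
  have hL0 : 0 ≤ L := le_trans (by positivity) hL
  obtain ⟨F, hFa, hFv⟩ :=
    (harmonicOnNhd_comp_complexToE2 hv2 hlap).exists_analyticOnNhd_ball_re_eq
  have hF : DifferentiableOn ℂ F (ball 0 1) := hFa.differentiableOn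
  have hw : ContinuousOn (v ∘ complexToE2) (closedBall 0 1) := by
    refine hv.comp complexToE2.continuous.continuousOn fun z hz => ?_
    rwa [← complexToE2_preimage_closedBall] at hz
  set c : ℕ → ℂ := fun n => iteratedDeriv (n + 1) F 0 / (n + 1).factorial
  have hc : ∀ n : ℕ, ∫ θ in (0 : ℝ)..2 * π, (u (pt θ L) : ℂ) *
      Complex.exp (-((n + 1 : ℕ) * θ * Complex.I)) = π * c n := by
    intro n
    rw [← boundary_integral_mul_exp hF hw hFv n]
    simp_rw [Function.comp_apply, complexToE2_circleMap, hbd]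
  have hud : ∀ p, HasFDerivAt u (fderiv ℝ u p) p := fun p =>
    (hu.differentiable one_ne_zero p).hasFDerivAt
  have hd : Continuous (fderiv ℝ u) := hu.continuous_fderiv one_ne_zero
  set E := ∫ x in {x : E2 | x 0 ∈ Set.Icc (0:ℝ) (2 * Real.pi) ∧
    x 1 ∈ Set.Icc (0:ℝ) L}, ‖fderiv ℝ u x‖ ^ 2
  have hE : ∀ N : ℕ, π * ∑ n ∈ Finset.range N, (n + 1) * Real.tanh ((n + 1) * L) * ‖c n‖ ^ 2
      ≤ E := fun N =>
    (energy_ge_sum_tanh (U := fun x y => u (pt x y))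
      (Ux := fun x y => fderiv ℝ u (pt x y) (pt 1 0))
      (Uy := fun x y => fderiv ℝ u (pt x y) (pt 0 1)) hL0 (hu.continuous.comp continuous_pt)
      ((hd.comp continuous_pt).clm_apply continuous_const)
      ((hd.comp continuous_pt).clm_apply continuous_const)
      (fun x y => (hud _).comp_hasDerivAt x (hasDerivAt_pt_left x y))
      (fun x y => (hud _).comp_hasDerivAt y (hasDerivAt_pt_right x y))
      (fun y => by simpa using hper 0 y) hc N).trans
    (integral_partials_le_energy hu (by positivity) hL0)
  have hdisc : ∫ x in ball (0 : E2) 1, ‖fderiv ℝ v x‖ ^ 2 =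
      ∫ z in ball (0 : ℂ) 1, ‖deriv F z‖ ^ 2 := by
    rw [← setIntegral_ball_comp_complexToE2 fun x => ‖fderiv ℝ v x‖ ^ 2]
    refine setIntegral_congr_fun measurableSet_ball fun z hz => ?_
    have hn := isOpen_ball.mem_nhds hz
    have he : (fun z => (F z).re) =ᶠ[nhds z] v ∘ complexToE2 :=
      Filter.eventuallyEq_of_mem hn hFv
    simp only [← norm_fderiv_comp_complexToE2, ← he.fderiv_eq,
      norm_fderiv_re (hF.differentiableAt hn)]
  rw [hdisc]
  refine integral_ball_normSq_deriv_le hF fun N => ?_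
  refine le_trans ?_ (mul_le_mul_of_nonneg_left (hE N) (by positivity))
  rw [mul_left_comm]
  refine mul_le_mul_of_nonneg_left ?_ pi_pos.le
  rw [Finset.mul_sum]
  refine Finset.sum_le_sum fun n _ => ?_
  have ht := one_le_mul_tanh hL (x := (n + 1) * L) (by nlinarith [n.cast_nonneg (α := ℝ)])
  calc ((n : ℝ) + 1) * ‖c n‖ ^ 2 = 1 * (((n : ℝ) + 1) * ‖c n‖ ^ 2) := (one_mul _).symm
    _ ≤ _ := mul_le_mul_of_nonneg_right ht (by positivity)
    _ = _ := by ring
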